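/- Let S be a countably based, left-soft separative, (2,ω)-divisible Cu-semigroup satisfying (O5), (O6) and (O7), and let x ∈ S. Let σ(x) denote the supremum of L_x (which exists and is the largest strongly soft element below x). Then 2σ(x) = x + σ(x). -/

import Mathlib

open Set

/-- The way-below relation: `x ≪ y` if for every increasing sequence with a
supremum dominating `y`, some term of the sequence dominates `x`. -/
def WayBelow {S : Type*} [Preorder S] (x y : S) : Prop :=
  ∀ z : ℕ → S, Monotone z → ∀ s : S, IsLUB (Set.range z) s → y ≤ s → ∃ m : ℕ, x ≤ z m

/-- A Cu-semigroup: a positively ordered commutative monoid satisfying (O1)-(O4). -/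
class CuSemigroup (S : Type*) extends AddCommMonoid S, PartialOrder S where
  zero_le : ∀ x : S, 0 ≤ x
  add_mono : ∀ {a b c d : S}, a ≤ b → c ≤ d → a + c ≤ b + d
  O1 : ∀ z : ℕ → S, Monotone z → ∃ s : S, IsLUB (Set.range z) s
  O2 : ∀ x : S, ∃ z : ℕ → S, (∀ n, WayBelow (z n) (z (n + 1))) ∧ IsLUB (Set.range z) x
  O3 : ∀ {x' x y' y : S}, WayBelow x' x → WayBelow y' y → WayBelow (x' + y') (x + y)
  O4 : ∀ (x y : ℕ → S), Monotone x → Monotone y → ∀ sx sy : S,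
      IsLUB (Set.range x) sx → IsLUB (Set.range y) sy →
      IsLUB (Set.range fun n => x n + y n) (sx + sy)

variable {S : Type*}

lemma CuSemigroup.nsmul_mono [CuSemigroup S] (x : S) : Monotone fun n : ℕ => n • x := by
  intro n m h
  obtain ⟨k, rfl⟩ := Nat.exists_eq_add_of_le h
  show n • x ≤ (n + k) • x
  rw [add_nsmul]
  calc n • x = n • x + 0 := by rw [add_zero]
    _ ≤ n • x + k • x := CuSemigroup.add_mono le_rfl (CuSemigroup.zero_le _)

/-- `infty x` is the supremum of the increasing sequence `n • x`, i.e. `∞x`. -/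
noncomputable def infty [CuSemigroup S] (x : S) : S :=
  (CuSemigroup.O1 (fun n : ℕ => n • x) (CuSemigroup.nsmul_mono x)).choose

lemma infty_isLUB [CuSemigroup S] (x : S) :
    IsLUB (Set.range fun n : ℕ => n • x) (infty x) :=
  (CuSemigroup.O1 (fun n : ℕ => n • x) (CuSemigroup.nsmul_mono x)).choose_spec

/-- An element is strongly soft if every `x' ≪ x` admits `t` with `x' + t ≪ x`
and `x' ≪ ∞t`. -/
def StronglySoft [CuSemigroup S] (x : S) : Prop :=
  ∀ x' : S, WayBelow x' x → ∃ t : S, WayBelow (x' + t) x ∧ WayBelow x' (infty t)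

def SatisfiesO5 (S : Type*) [CuSemigroup S] : Prop :=
  ∀ x' x y' y z : S, WayBelow x' x → WayBelow y' y → x + y ≤ z →
    ∃ c : S, WayBelow y' c ∧ x' + c ≤ z ∧ z ≤ x + c

def SatisfiesO6 (S : Type*) [CuSemigroup S] : Prop :=
  ∀ x' x y z : S, WayBelow x' x → WayBelow x (y + z) →
    ∃ v w : S, v ≤ x ∧ v ≤ y ∧ w ≤ x ∧ w ≤ z ∧ x' ≤ v + w

def SatisfiesO7 (S : Type*) [CuSemigroup S] : Prop :=
  ∀ x' x y' y w : S, WayBelow x' x → x ≤ w → WayBelow y' y → y ≤ w →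
    ∃ z : S, WayBelow x' z ∧ WayBelow y' z ∧ z ≤ w ∧ z ≤ x + y

def TwoOmegaDivisible (S : Type*) [CuSemigroup S] : Prop :=
  ∀ x' x : S, WayBelow x' x → ∃ y : S, 2 • y ≤ x ∧ x' ≤ infty y

def WeaklyCancellative (S : Type*) [CuSemigroup S] : Prop :=
  ∀ x y z : S, WayBelow (x + z) (y + z) → WayBelow x y

def Separative (S : Type*) [CuSemigroup S] : Prop :=
  ∀ x y t : S, WayBelow (x + t) (y + t) → WayBelow t (infty x) → WayBelow t (infty y) →
    WayBelow x y

def LeftSoftSeparative (S : Type*) [CuSemigroup S] : Prop :=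
  ∀ x y t : S, StronglySoft x → WayBelow (x + t) (y + t) → WayBelow t (infty x) →
    WayBelow t (infty y) → WayBelow x y

def AlmostUnperforated (S : Type*) [CuSemigroup S] : Prop :=
  ∀ x y : S, (∃ n : ℕ, 1 ≤ n ∧ (n + 1) • x ≤ n • y) → x ≤ y

def CountablyBased (S : Type*) [CuSemigroup S] : Prop :=
  ∃ D : Set S, D.Countable ∧
    ∀ x : S, ∃ z : ℕ → S, Monotone z ∧ (∀ n, z n ∈ D) ∧ IsLUB (Set.range z) x

/-- `Lset x` is the set `L_x = { u' : u' ≪ u ≪ x for some strongly soft u }`. -/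
def Lset [CuSemigroup S] (x : S) : Set S :=
  { u' | ∃ u : S, StronglySoft u ∧ WayBelow u' u ∧ WayBelow u x }

/-- A functional on a Cu-semigroup: a monoid morphism to `[0,∞]` preserving order
and suprema of increasing sequences. -/
structure CuFunctional (S : Type*) [CuSemigroup S] where
  toFun : S → ENNReal
  map_zero : toFun 0 = 0
  map_add : ∀ x y : S, toFun (x + y) = toFun x + toFun y
  mono : ∀ x y : S, x ≤ y → toFun x ≤ toFun y
  map_sup : ∀ z : ℕ → S, Monotone z → ∀ s : S, IsLUB (Set.range z) s →
    toFun s = ⨆ n, toFun (z n)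

/-- Predicate version: `f : S → [0,∞]` is a functional on `S`. -/
def IsCuFunctional [CuSemigroup S] (f : S → ENNReal) : Prop :=
  f 0 = 0 ∧ (∀ x y : S, f (x + y) = f x + f y) ∧ (∀ x y : S, x ≤ y → f x ≤ f y) ∧
  (∀ z : ℕ → S, Monotone z → ∀ s : S, IsLUB (Set.range z) s → f s = ⨆ n, f (z n))

/-- Least upper bound of `A` computed within the subset `T`. -/
def IsLUBIn [CuSemigroup S] (T : Set S) (A : Set S) (s : S) : Prop :=
  s ∈ T ∧ s ∈ upperBounds A ∧ ∀ b ∈ T, b ∈ upperBounds A → s ≤ b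

/-- The way-below relation computed within the subset `T`. -/
def WayBelowIn [CuSemigroup S] (T : Set S) (x y : S) : Prop :=
  ∀ z : ℕ → S, Monotone z → (∀ n, z n ∈ T) → ∀ s : S, IsLUBIn T (Set.range z) s → y ≤ s →
    ∃ m : ℕ, x ≤ z m

/-- `T` is a sub-Cu-semigroup of `S`: a submonoid which is itself a Cu-semigroup
for the inherited order, such that the inclusion preserves suprema of increasing
sequences and the way-below relation. -/
structure IsSubCuSemigroup [CuSemigroup S] (T : Set S) : Prop where
  zero_mem : (0 : S) ∈ T
  add_mem : ∀ {x y : S}, x ∈ T → y ∈ T → x + y ∈ T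
  o1 : ∀ z : ℕ → S, Monotone z → (∀ n, z n ∈ T) → ∃ s : S, IsLUBIn T (Set.range z) s
  o2 : ∀ x ∈ T, ∃ z : ℕ → S, (∀ n, z n ∈ T) ∧ (∀ n, WayBelowIn T (z n) (z (n + 1))) ∧
        IsLUBIn T (Set.range z) x
  o3 : ∀ {x' x y' y : S}, x' ∈ T → x ∈ T → y' ∈ T → y ∈ T →
        WayBelowIn T x' x → WayBelowIn T y' y → WayBelowIn T (x' + y') (x + y)
  o4 : ∀ (x y : ℕ → S), Monotone x → Monotone y → (∀ n, x n ∈ T) → (∀ n, y n ∈ T) →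
        ∀ sx sy : S, IsLUBIn T (Set.range x) sx → IsLUBIn T (Set.range y) sy →
        IsLUBIn T (Set.range fun n => x n + y n) (sx + sy)
  incl_sup : ∀ z : ℕ → S, Monotone z → (∀ n, z n ∈ T) → ∀ s : S,
        IsLUBIn T (Set.range z) s → IsLUB (Set.range z) s
  incl_wayBelow : ∀ {x y : S}, x ∈ T → y ∈ T → WayBelowIn T x y → WayBelow x y

def SatisfiesO5In [CuSemigroup S] (T : Set S) : Prop :=
  ∀ x' x y' y z : S, x' ∈ T → x ∈ T → y' ∈ T → y ∈ T → z ∈ T →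
    WayBelowIn T x' x → WayBelowIn T y' y → x + y ≤ z →
    ∃ c ∈ T, WayBelowIn T y' c ∧ x' + c ≤ z ∧ z ≤ x + c

def SatisfiesO6In [CuSemigroup S] (T : Set S) : Prop :=
  ∀ x' x y z : S, x' ∈ T → x ∈ T → y ∈ T → z ∈ T →
    WayBelowIn T x' x → WayBelowIn T x (y + z) →
    ∃ v ∈ T, ∃ w ∈ T, v ≤ x ∧ v ≤ y ∧ w ≤ x ∧ w ≤ z ∧ x' ≤ v + w

def SatisfiesO7In [CuSemigroup S] (T : Set S) : Prop :=
  ∀ x' x y' y w : S, x' ∈ T → x ∈ T → y' ∈ T → y ∈ T → w ∈ T →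
    WayBelowIn T x' x → x ≤ w → WayBelowIn T y' y → y ≤ w →
    ∃ z ∈ T, WayBelowIn T x' z ∧ WayBelowIn T y' z ∧ z ≤ w ∧ z ≤ x + y

/-- `f` is a functional on the sub-Cu-semigroup `T` (values off `T` are irrelevant). -/
def IsFunctionalOn [CuSemigroup S] (T : Set S) (f : S → ENNReal) : Prop :=
  f 0 = 0 ∧
  (∀ x ∈ T, ∀ y ∈ T, f (x + y) = f x + f y) ∧
  (∀ x ∈ T, ∀ y ∈ T, x ≤ y → f x ≤ f y) ∧
  (∀ z : ℕ → S, Monotone z → (∀ n, z n ∈ T) → ∀ s : S, IsLUBIn T (Set.range z) s →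
    f s = ⨆ n, f (z n))

/-- An element is full if `x ≤ ∞e` for every `x`. -/
def IsFull [CuSemigroup S] (e : S) : Prop := ∀ x : S, x ≤ infty e

/-- Condition (R1) for `r`: comparison of `x` with `y` whenever
`λ(x) + r·λ(e) ≤ λ(y)` for all functionals. -/
def SatisfiesR1 (S : Type*) [CuSemigroup S] (e : S) (r : NNReal) : Prop :=
  ∀ x y : S,
    (∀ lam : CuFunctional S, lam.toFun x + (r : ENNReal) * lam.toFun e ≤ lam.toFun y) → x ≤ y

/-- The radius of comparison of `(S, e)`. -/
noncomputable def rc (S : Type*) [CuSemigroup S] (e : S) : ENNReal :=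
  ⨅ r ∈ {r : NNReal | 0 < r ∧ SatisfiesR1 S e r}, (r : ENNReal)

/-- Condition (R1) for the sub-Cu-semigroup `T`. -/
def SatisfiesR1On [CuSemigroup S] (T : Set S) (e : S) (r : NNReal) : Prop :=
  ∀ x ∈ T, ∀ y ∈ T,
    (∀ f : S → ENNReal, IsFunctionalOn T f → f x + (r : ENNReal) * f e ≤ f y) → x ≤ y

/-- The radius of comparison of `(T, e)` for a sub-Cu-semigroup `T ⊆ S`. -/
noncomputable def rcOn [CuSemigroup S] (T : Set S) (e : S) : ENNReal :=
  ⨅ r ∈ {r : NNReal | 0 < r ∧ SatisfiesR1On T e r}, (r : ENNReal)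

/-- `dim S ≤ n` in the sense of covering dimension of Cu-semigroups. -/
def DimLe (S : Type*) [CuSemigroup S] (n : ℕ) : Prop :=
  ∀ (x' x : S) (r : ℕ) (y : Fin r → S), WayBelow x' x → WayBelow x (∑ j, y j) →
    ∃ z : Fin r → Fin (n + 1) → S,
      (∀ j k, WayBelow (z j k) (y j)) ∧
      WayBelow x' (∑ j, ∑ k, z j k) ∧
      (∀ k, WayBelow (∑ j, z j k) x)

/-- The covering dimension of a Cu-semigroup, in `ℕ ∪ {∞}`. -/
noncomputable def cuDim (S : Type*) [CuSemigroup S] : ℕ∞ :=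
  ⨅ n ∈ {n : ℕ | DimLe S n}, (n : ℕ∞)

/-- `dim T ≤ n` for a sub-Cu-semigroup `T ⊆ S`. -/
def DimLeOn [CuSemigroup S] (T : Set S) (n : ℕ) : Prop :=
  ∀ (x' x : S), x' ∈ T → x ∈ T → ∀ (r : ℕ) (y : Fin r → S), (∀ j, y j ∈ T) →
    WayBelowIn T x' x → WayBelowIn T x (∑ j, y j) →
    ∃ z : Fin r → Fin (n + 1) → S,
      (∀ j k, z j k ∈ T) ∧
      (∀ j k, WayBelowIn T (z j k) (y j)) ∧
      WayBelowIn T x' (∑ j, ∑ k, z j k) ∧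
      (∀ k, WayBelowIn T (∑ j, z j k) x)

/-- The covering dimension of a sub-Cu-semigroup `T ⊆ S`. -/
noncomputable def cuDimOn [CuSemigroup S] (T : Set S) : ℕ∞ :=
  ⨅ n ∈ {n : ℕ | DimLeOn T n}, (n : ℕ∞)

section WayBelowCalculus

local infix:50 "≪" => WayBelow

variable [CuSemigroup S]

instance CuSemigroup.isOrderedAddMonoid : IsOrderedAddMonoid S where
  add_le_add_left _ _ h _ := CuSemigroup.add_mono h le_rfl

lemma CuSemigroup.le_add_self (x y : S) : x ≤ y + x := by
  simpa using add_le_add_left (CuSemigroup.zero_le y) x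

lemma CuSemigroup.self_le_add (x y : S) : x ≤ x + y := by
  simpa using add_le_add_right (CuSemigroup.zero_le y) x

lemma WayBelow.le {x y : S} (h : x ≪ y) : x ≤ y := by
  obtain ⟨_, hm⟩ := h (fun _ => y) monotone_const y (by simp) le_rfl
  exact hm

lemma WayBelow.trans_le {x y z : S} (h : x ≪ y) (hyz : y ≤ z) : x ≪ z :=
  fun w hw s hs hzs => h w hw s hs (hyz.trans hzs)

lemma WayBelow.of_le {x y z : S} (hxy : x ≤ y) (h : y ≪ z) : x ≪ z := by
  intro w hw s hs hzs
  obtain ⟨m, hm⟩ := h w hw s hs hzs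
  exact ⟨m, hxy.trans hm⟩

lemma WayBelow.trans {x y z : S} (h : x ≪ y) (h' : y ≪ z) : x ≪ z :=
  h.trans_le h'.le

lemma WayBelow.add {x' x y' y : S} (hx : x' ≪ x) (hy : y' ≪ y) : x' + y' ≪ x + y :=
  CuSemigroup.O3 hx hy

/-- Every element is the supremum of a monotone sequence of elements way below it. -/
lemma exists_approx (x : S) :
    ∃ z : ℕ → S, Monotone z ∧ (∀ n, z n ≪ x) ∧ IsLUB (range z) x := by
  obtain ⟨z, hz, hx⟩ := CuSemigroup.O2 x
  exact ⟨z, monotone_nat_of_le_succ fun n => (hz n).le,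
    fun n => (hz n).trans_le (hx.1 ⟨n + 1, rfl⟩), hx⟩

lemma WayBelow.exists_between {x y : S} (h : x ≪ y) : ∃ m, x ≪ m ∧ m ≪ y := by
  obtain ⟨z, hz, hy⟩ := CuSemigroup.O2 y
  obtain ⟨n, hn⟩ := h z (monotone_nat_of_le_succ fun n => (hz n).le) y hy le_rfl
  exact ⟨z (n + 1), (hz n).of_le hn, (hz (n + 1)).trans_le (hy.1 ⟨n + 2, rfl⟩)⟩

/-- An element way below a sum is way below a sum of elements way below the summands. -/
lemma WayBelow.exists_add {p x y : S} (h : p ≪ x + y) :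
    ∃ x' y', x' ≪ x ∧ y' ≪ y ∧ p ≪ x' + y' := by
  obtain ⟨q, hpq, hq⟩ := h.exists_between
  obtain ⟨a, ha, hax, hx⟩ := exists_approx x
  obtain ⟨b, hb, hby, hy⟩ := exists_approx y
  obtain ⟨n, hn⟩ := hq _ (ha.add hb) _ (CuSemigroup.O4 a b ha hb x y hx hy) le_rfl
  exact ⟨a n, b n, hax n, hby n, hpq.trans_le hn⟩

lemma add_le_of_forall_wayBelow {x y z : S}
    (h : ∀ x' y', x' ≪ x → y' ≪ y → x' + y' ≤ z) : x + y ≤ z := by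
  obtain ⟨a, ha, hax, hx⟩ := exists_approx x
  obtain ⟨b, hb, hby, hy⟩ := exists_approx y
  refine (CuSemigroup.O4 a b ha hb x y hx hy).2 ?_
  rintro _ ⟨n, rfl⟩
  exact h _ _ (hax n) (hby n)

lemma le_of_forall_wayBelow {x z : S} (h : ∀ x', x' ≪ x → x' ≤ z) : x ≤ z := by
  obtain ⟨a, -, hax, hx⟩ := exists_approx x
  refine hx.2 ?_
  rintro _ ⟨n, rfl⟩
  exact h _ (hax n)

lemma WayBelow.exists_max {a b x : S} (ha : a ≪ x) (hb : b ≪ x) :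
    ∃ m, a ≤ m ∧ b ≤ m ∧ m ≪ x := by
  obtain ⟨z, hz, hzx, hx⟩ := exists_approx x
  obtain ⟨i, hi⟩ := ha z hz x hx le_rfl
  obtain ⟨j, hj⟩ := hb z hz x hx le_rfl
  exact ⟨z (max i j), hi.trans (hz (le_max_left _ _)), hj.trans (hz (le_max_right _ _)), hzx _⟩

lemma nsmul_le_infty (n : ℕ) (x : S) : n • x ≤ infty x :=
  (infty_isLUB x).1 ⟨n, rfl⟩

lemma le_infty (x : S) : x ≤ infty x := by
  simpa using nsmul_le_infty 1 x

lemma infty_add_infty_le (x : S) : infty x + infty x ≤ infty x := by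
  refine (CuSemigroup.O4 _ _ (CuSemigroup.nsmul_mono x) (CuSemigroup.nsmul_mono x) _ _
    (infty_isLUB x) (infty_isLUB x)).2 ?_
  rintro _ ⟨n, rfl⟩
  simpa [add_nsmul] using nsmul_le_infty (n + n) x

lemma add_le_infty {a b x : S} (ha : a ≤ infty x) (hb : b ≤ infty x) : a + b ≤ infty x :=
  (add_le_add ha hb).trans (infty_add_infty_le x)

lemma nsmul_le_infty_of_le {a x : S} (ha : a ≤ infty x) (n : ℕ) : n • a ≤ infty x := by
  induction n with
  | zero => simpa using CuSemigroup.zero_le _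
  | succ n ih => simpa [succ_nsmul] using add_le_infty ih ha

lemma infty_le_infty {a x : S} (ha : a ≤ infty x) : infty a ≤ infty x := by
  refine (infty_isLUB a).2 ?_
  rintro _ ⟨n, rfl⟩
  exact nsmul_le_infty_of_le ha n

lemma infty_mono {a x : S} (h : a ≤ x) : infty a ≤ infty x :=
  infty_le_infty (h.trans (le_infty x))

lemma WayBelow.exists_le_nsmul {a x : S} (h : a ≪ infty x) : ∃ n : ℕ, a ≤ n • x :=
  h _ (CuSemigroup.nsmul_mono x) _ (infty_isLUB x) le_rfl

lemma WayBelow.exists_nsmul {a x : S} (n : ℕ) (h : a ≪ n • x) : ∃ x', x' ≪ x ∧ a ≤ n • x' := by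
  induction n generalizing a with
  | zero =>
    obtain ⟨z, -, hz, -⟩ := exists_approx x
    exact ⟨z 0, hz 0, by simpa using h.le⟩
  | succ n ih =>
    rw [succ_nsmul] at h
    obtain ⟨b, c, hb, hc, habc⟩ := h.exists_add
    obtain ⟨y, hy, hby⟩ := ih hb
    obtain ⟨m, hym, hcm, hm⟩ := hy.exists_max hc
    refine ⟨m, hm, habc.le.trans ?_⟩
    rw [succ_nsmul]
    exact add_le_add (hby.trans (nsmul_le_nsmul_right hym n)) hcm

lemma WayBelow.exists_infty {a x : S} (h : a ≪ infty x) : ∃ x', x' ≪ x ∧ a ≪ infty x' := by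
  obtain ⟨b, hab, hb⟩ := h.exists_between
  obtain ⟨c, hbc, hc⟩ := hb.exists_between
  obtain ⟨n, hn⟩ := hc.exists_le_nsmul
  obtain ⟨y, hy, hby⟩ := (hbc.trans_le hn).exists_nsmul
  exact ⟨y, hy, hab.trans_le (hby.trans (nsmul_le_infty n y))⟩

lemma StronglySoft.add_of_le_infty {c r : S} (hr : StronglySoft r) (hc : c ≤ infty r) :
    StronglySoft (c + r) := by
  intro y hy
  obtain ⟨c', r', hc', hr', hyc⟩ := hy.exists_add
  obtain ⟨q, hq, hcq⟩ := (hc'.trans_le hc).exists_infty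
  obtain ⟨m, hrm, hqm, hm⟩ := hr'.exists_max hq
  obtain ⟨t, htr, hmt⟩ := hr m hm
  refine ⟨t, (hc'.add htr).of_le ?_, hyc.trans_le (add_le_infty ?_ ?_)⟩
  · rw [← add_assoc]
    exact add_le_add (hyc.le.trans (add_le_add le_rfl hrm)) le_rfl
  · exact hcq.le.trans (infty_le_infty (hqm.trans hmt.le))
  · exact hrm.trans hmt.le

/-- The supremum of a series whose terms lie in increasing ideals is strongly soft. -/
lemma stronglySoft_of_isLUB_sum {a : ℕ → S} (ha : ∀ n, a n ≪ infty (a (n + 1))) {u : S}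
    (hu : IsLUB (range fun n => ∑ k ∈ Finset.range n, a k) u) : StronglySoft u := by
  have hmono : Monotone fun n => ∑ k ∈ Finset.range n, a k :=
    monotone_nat_of_le_succ fun n => by
      rw [Finset.sum_range_succ]
      exact CuSemigroup.self_le_add _ _
  have hideal : ∀ n, ∑ k ∈ Finset.range n, a k ≪ infty (a n) := by
    intro n
    induction n with
    | zero => exact fun z _ _ _ _ => ⟨0, by simpa using CuSemigroup.zero_le _⟩
    | succ n ih =>
      rw [Finset.sum_range_succ]
      exact ((ih.trans_le (infty_le_infty (ha n).le)).add (ha n)).trans_le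
        (infty_add_infty_le _)
  intro w hw
  obtain ⟨w₁, hww₁, hw₁⟩ := hw.exists_between
  obtain ⟨n, hn⟩ := hw₁ _ hmono u hu le_rfl
  obtain ⟨t, hta, ht⟩ := (hideal n).exists_infty
  refine ⟨t, ((hww₁.trans_le hn).add hta).trans_le ?_, ht.of_le (hww₁.le.trans hn)⟩
  have := hu.1 ⟨n + 1, rfl⟩
  simpa [Finset.sum_range_succ] using this

lemma TwoOmegaDivisible.exists_nsmul_le (hdiv : TwoOmegaDivisible S) {a b : S}
    (h : a ≪ infty b) (n : ℕ) : ∃ y, n • y ≤ b ∧ a ≪ infty y := by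
  have hpow : ∀ k : ℕ, ∃ y, 2 ^ k • y ≤ b ∧ a ≪ infty y := by
    intro k
    induction k with
    | zero => exact ⟨b, by simp, h⟩
    | succ k ih =>
      obtain ⟨y, hyb, hy⟩ := ih
      obtain ⟨y', hy', hay'⟩ := hy.exists_infty
      obtain ⟨z, hz, hyz⟩ := hdiv y' y hy'
      refine ⟨z, ?_, hay'.trans_le (infty_le_infty hyz)⟩
      rw [pow_succ, mul_nsmul']
      exact (nsmul_le_nsmul_right hz _).trans hyb
  obtain ⟨y, hyb, hy⟩ := hpow n
  exact ⟨y, (CuSemigroup.nsmul_mono y Nat.lt_two_pow_self.le).trans hyb, hy⟩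

lemma TwoOmegaDivisible.exists_stronglySoft_le (hdiv : TwoOmegaDivisible S) {a b : S}
    (h : a ≪ b) : ∃ u, StronglySoft u ∧ u ≤ b ∧ a ≪ infty u := by
  have step : ∀ p : {p : S × S // p.1 ≪ p.2}, ∃ q : {p : S × S // p.1 ≪ p.2},
      p.1.1 ≪ infty q.1.1 ∧ 2 • q.1.2 ≤ p.1.2 := by
    rintro ⟨⟨a, b⟩, hab⟩
    obtain ⟨e, hae, heb⟩ := WayBelow.exists_between hab
    obtain ⟨y, hyb, hey⟩ := hdiv e b heb
    obtain ⟨y', hy', hay'⟩ := (hae.trans_le hey).exists_infty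
    exact ⟨⟨(y', y), hy'⟩, hay', hyb⟩
  choose next hnext hhalf using step
  let p : ℕ → {p : S × S // p.1 ≪ p.2} := fun n => next^[n] ⟨(a, b), h⟩
  have hp : ∀ n, p (n + 1) = next (p n) := fun n => Function.iterate_succ_apply' _ _ _
  have hideal : ∀ n, (p n).1.1 ≪ infty (p (n + 1)).1.1 := fun n => hp n ▸ hnext (p n)
  have hle : ∀ n, 2 • (p (n + 1)).1.2 ≤ (p n).1.2 := fun n => hp n ▸ hhalf (p n)
  have hbound : ∀ n, ∑ k ∈ Finset.range n, (p (k + 1)).1.1 + (p n).1.2 ≤ b := by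
    intro n
    induction n with
    | zero => simp [p]
    | succ n ih =>
      rw [Finset.sum_range_succ, add_assoc]
      refine le_trans (add_le_add le_rfl ?_) ih
      exact (add_le_add (p (n + 1)).2.le le_rfl).trans ((two_nsmul _).symm.le.trans (hle n))
  obtain ⟨u, hu⟩ := CuSemigroup.O1 (fun n => ∑ k ∈ Finset.range n, (p (k + 1)).1.1)
    (monotone_nat_of_le_succ fun n => by
      rw [Finset.sum_range_succ]
      exact CuSemigroup.self_le_add _ _)
  refine ⟨u, stronglySoft_of_isLUB_sum (fun n => hideal (n + 1)) hu, hu.2 ?_, ?_⟩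
  · rintro _ ⟨n, rfl⟩
    exact (CuSemigroup.self_le_add _ _).trans (hbound n)
  · refine (hideal 0).trans_le (infty_mono ?_)
    have := hu.1 ⟨1, rfl⟩
    simpa using this

/-- Below any element there are arbitrarily divided strongly soft elements generating
almost the same ideal. -/
lemma TwoOmegaDivisible.exists_stronglySoft (hdiv : TwoOmegaDivisible S) {a b : S}
    (h : a ≪ infty b) (n : ℕ) : ∃ u, StronglySoft u ∧ n • u ≤ b ∧ a ≪ infty u := by
  obtain ⟨y, hyb, hy⟩ := hdiv.exists_nsmul_le h n
  obtain ⟨y', hy', hay'⟩ := hy.exists_infty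
  obtain ⟨u, hu, huy, hyu⟩ := hdiv.exists_stronglySoft_le hy'
  exact ⟨u, hu, (nsmul_le_nsmul_right huy n).trans hyb, hay'.trans_le (infty_le_infty hyu.le)⟩

lemma StronglySoft.exists_between (hdiv : TwoOmegaDivisible S) {u' u : S}
    (hu : StronglySoft u) (h : u' ≪ u) : ∃ w, StronglySoft w ∧ u' ≪ w ∧ w ≪ u := by
  obtain ⟨v, huv, hv⟩ := h.exists_between
  obtain ⟨t, hvt, ht⟩ := hu v hv
  obtain ⟨r, hr, hrt, hvr⟩ := hdiv.exists_stronglySoft ht 1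
  rw [one_nsmul] at hrt
  exact ⟨v + r, hr.add_of_le_infty hvr.le, huv.trans_le (CuSemigroup.self_le_add _ _),
    hvt.of_le (add_le_add le_rfl hrt)⟩

lemma SatisfiesO6.exists_le_of_le_nsmul (hO6 : SatisfiesO6 S) (hO7 : SatisfiesO7 S)
    {p' p x : S} (n : ℕ) (hp : p' ≪ p) (h : p ≤ n • x) :
    ∃ w, w ≤ x ∧ w ≤ n • p ∧ p' ≪ infty w := by
  induction n generalizing p' p with
  | zero =>
    refine ⟨0, CuSemigroup.zero_le _, CuSemigroup.zero_le _, hp.trans_le (h.trans ?_)⟩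
    simpa using CuSemigroup.zero_le _
  | succ n ih =>
    obtain ⟨p₁, hp₁, hp₁p⟩ := hp.exists_between
    obtain ⟨p₂, hp₂, hp₂p⟩ := hp₁p.exists_between
    obtain ⟨v, w, hvp, hvx, hwp, hwx, hvw⟩ :=
      hO6 p₁ p₂ (n • x) x hp₂ (hp₂p.trans_le (h.trans (succ_nsmul x n).le))
    obtain ⟨v', w', hv', hw', hpvw⟩ := (hp₁.trans_le hvw).exists_add
    obtain ⟨y, hyx, hyv, hvy⟩ := ih hv' hvx
    obtain ⟨y', hy', hvy'⟩ := hvy.exists_infty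
    obtain ⟨z, hyz, hwz, hzx, hz⟩ := hO7 y' y w' w x hy' hyx hw' hwx
    refine ⟨z, hzx, hz.trans ?_, hpvw.trans_le (add_le_infty ?_ ?_)⟩
    · rw [succ_nsmul]
      exact add_le_add (hyv.trans (nsmul_le_nsmul_right (hvp.trans hp₂p.le) n))
        (hwp.trans hp₂p.le)
    · exact hvy'.le.trans (infty_mono hyz.le)
    · exact hwz.le.trans (le_infty z)

/-- If `p` lies in the ideals generated by `g` and by `h`, then any `p' ≪ p` lies in the ideal
generated by a common lower bound of `g` and `h`. -/
lemma TwoOmegaDivisible.exists_le_le (hdiv : TwoOmegaDivisible S)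
    (hO6 : SatisfiesO6 S) (hO7 : SatisfiesO7 S) {p' p g h : S} (hp : p' ≪ p)
    (hg : p ≤ infty g) (hh : p ≤ infty h) : ∃ e, e ≤ g ∧ e ≤ h ∧ p' ≪ infty e := by
  obtain ⟨q, hpq, hq⟩ := hp.exists_between
  obtain ⟨n, hn⟩ := (hq.trans_le hg).exists_le_nsmul
  obtain ⟨g₀, hg₀, hg₀q, hpg₀⟩ := hO6.exists_le_of_le_nsmul hO7 n hpq hn
  obtain ⟨g₁, hg₁, hpg₁⟩ := hpg₀.exists_infty
  have hg₁h : g₁ ≪ infty h :=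
    hg₁.trans_le (hg₀q.trans (nsmul_le_infty_of_le (hq.le.trans hh) n))
  obtain ⟨m, hm⟩ := hg₁h.exists_le_nsmul
  obtain ⟨y, hyg, hpy⟩ := hdiv.exists_nsmul_le hpg₁ (m + 1)
  obtain ⟨y', hy', hpy'⟩ := hpy.exists_infty
  have hyh : y ≤ (m + 1) • h :=
    calc y ≤ (m + 1) • y := by
          rw [succ_nsmul]
          exact CuSemigroup.le_add_self _ _
      _ ≤ m • h := hyg.trans hm
      _ ≤ (m + 1) • h := CuSemigroup.nsmul_mono h m.le_succ
  obtain ⟨e, heh, hey, hye⟩ := hO6.exists_le_of_le_nsmul hO7 (m + 1) hy' hyh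
  exact ⟨e, (hey.trans hyg).trans (hg₁.le.trans hg₀), heh, hpy'.trans_le (infty_le_infty hye.le)⟩

/-- An element way below a strongly soft element below `x` leaves room in `x` for two copies of
a strongly soft element generating almost the same ideal as `x`. -/
lemma StronglySoft.exists_complement (hdiv : TwoOmegaDivisible S) (hO5 : SatisfiesO5 S)
    {u' u x p : S} (hu : StronglySoft u) (hux : u ≤ x) (hu' : u' ≪ u) (hp : p ≪ infty x) :
    ∃ g, StronglySoft g ∧ u' + 2 • g ≤ x ∧ u' ≤ infty g ∧ p ≪ infty g := by
  obtain ⟨v, huv, hv⟩ := hu'.exists_between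
  obtain ⟨t, hvt, ht⟩ := hu v hv
  obtain ⟨t', ht', hvt'⟩ := ht.exists_infty
  obtain ⟨c, htc, hcx, hxc⟩ := hO5 u' v t' t x huv ht' (hvt.le.trans hux)
  have hx : x ≤ infty c :=
    hxc.trans (add_le_infty (hvt'.le.trans (infty_mono htc.le)) (le_infty c))
  have hpc : p + u' ≪ infty c :=
    ((hp.trans_le (infty_le_infty hx)).add (hu'.trans_le (hux.trans hx))).trans_le
      (infty_add_infty_le c)
  obtain ⟨g, hg, hgc, hpg⟩ := hdiv.exists_stronglySoft hpc 2
  exact ⟨g, hg, (add_le_add le_rfl hgc).trans hcx,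
    (CuSemigroup.le_add_self _ _).trans hpg.le, hpg.of_le (CuSemigroup.self_le_add _ _)⟩

lemma LeftSoftSeparative.exists_stronglySoft_ge (hsep : LeftSoftSeparative S)
    (hdiv : TwoOmegaDivisible S) (hO5 : SatisfiesO5 S) (hO6 : SatisfiesO6 S)
    (hO7 : SatisfiesO7 S) {u' u v' v x : S} (hu : StronglySoft u) (hv : StronglySoft v)
    (hux : u ≤ x) (hvx : v ≤ x) (hu' : u' ≪ u) (hv' : v' ≪ v) :
    ∃ w, StronglySoft w ∧ w ≤ x ∧ u' ≤ w ∧ v' ≤ w := by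
  obtain ⟨u₁, hu₁, hu₁u⟩ := hu'.exists_between
  obtain ⟨u₂, hu₂, hu₂u⟩ := hu₁u.exists_between
  obtain ⟨v₁, hv₁, hv₁v⟩ := hv'.exists_between
  obtain ⟨v₂, hv₂, hv₂v⟩ := hv₁v.exists_between
  have hp : u₂ + v₂ ≪ infty x :=
    ((hu₂u.trans_le hux).add (hv₂v.trans_le hvx)).trans_le
      (add_le_infty (le_infty x) (le_infty x))
  obtain ⟨g, -, hgx, -, hpg⟩ := hu.exists_complement hdiv hO5 hux hu₂u hp
  obtain ⟨h, hh, hhx, hv₂h, hph⟩ := hv.exists_complement hdiv hO5 hvx hv₂v hp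
  obtain ⟨e, heg, heh, hpe⟩ := hdiv.exists_le_le hO6 hO7 (hu₂.add hv₂) hpg.le hph.le
  obtain ⟨e₁, he₁, hpe₁⟩ := hpe.exists_infty
  obtain ⟨e', he', hpe'⟩ := hpe₁.exists_infty
  obtain ⟨r, hr, hre, hpr⟩ := hdiv.exists_stronglySoft hpe' 1
  rw [one_nsmul] at hre
  obtain ⟨g', hg', heg'⟩ := (he₁.trans_le (heg.trans (le_infty g))).exists_infty
  have he₁x : e₁ + (u₂ + g) ≤ x :=
    calc e₁ + (u₂ + g) ≤ g + (u₂ + g) := add_le_add (he₁.le.trans heg) le_rfl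
      _ = u₂ + 2 • g := by rw [two_nsmul]; abel
      _ ≤ x := hgx
  obtain ⟨c, hgc, hcx, hxc⟩ := hO5 e' e₁ (u₁ + g') (u₂ + g) x he' (hu₂.add hg') he₁x
  have hehv : e₁ + v₁ ≪ infty h :=
    (he₁.add hv₂).trans_le (add_le_infty (heh.trans (le_infty h)) hv₂h)
  obtain ⟨h', hh', heh'⟩ := hehv.exists_infty
  obtain ⟨k, hk, hhk, hkh⟩ := hh.exists_between hdiv hh'
  have hek : e₁ + v₁ ≪ infty k := heh'.trans_le (infty_mono hhk.le)
  have hsoft : StronglySoft (v₁ + k) :=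
    hk.add_of_le_infty ((CuSemigroup.le_add_self _ _).trans hek.le)
  have hcancel : v₁ + k + e₁ ≪ c + e₁ := by
    refine ((hv₂.add hkh).add he₁).trans_le ?_
    calc v₂ + h + e ≤ v₂ + h + h := add_le_add le_rfl heh
      _ = v₂ + 2 • h := by rw [two_nsmul, add_assoc]
      _ ≤ x := hhx
      _ ≤ c + e₁ := hxc.trans (add_comm _ _).le
  have hvc : v₁ + k ≪ c := by
    refine hsep _ _ _ hsoft hcancel ?_ ?_
    · exact (hek.of_le (CuSemigroup.self_le_add _ _)).trans_le
        (infty_mono (CuSemigroup.le_add_self _ _))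
    · exact heg'.trans_le (infty_mono ((CuSemigroup.le_add_self _ _).trans hgc.le))
  obtain ⟨d, hud, hvd, hdc, hd⟩ := hO7 u' u₁ v' v₁ c hu₁
    ((CuSemigroup.self_le_add _ _).trans hgc.le) hv₁
    ((CuSemigroup.self_le_add _ _).trans hvc.le)
  refine ⟨d + r, hr.add_of_le_infty (hd.trans hpr.le), ?_,
    hud.le.trans (CuSemigroup.self_le_add _ _), hvd.le.trans (CuSemigroup.self_le_add _ _)⟩
  exact (add_le_add hdc hre).trans ((add_comm _ _).le.trans hcx)

lemma StronglySoft.mem_Lset (hdiv : TwoOmegaDivisible S) {w' w x : S} (hw : StronglySoft w)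
    (hwx : w ≤ x) (hw' : w' ≪ w) : w' ∈ Lset x := by
  obtain ⟨m, hm, hwm, hmw⟩ := hw.exists_between hdiv hw'
  exact ⟨m, hm, hwm, hmw.trans_le hwx⟩

lemma StronglySoft.le_of_isLUB_Lset (hdiv : TwoOmegaDivisible S) {w x s : S}
    (hw : StronglySoft w) (hwx : w ≤ x) (hs : IsLUB (Lset x) s) : w ≤ s :=
  le_of_forall_wayBelow fun _ h => hs.1 (hw.mem_Lset hdiv hwx h)

lemma LeftSoftSeparative.directedOn_Lset (hsep : LeftSoftSeparative S)
    (hdiv : TwoOmegaDivisible S) (hO5 : SatisfiesO5 S) (hO6 : SatisfiesO6 S)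
    (hO7 : SatisfiesO7 S) (x : S) : DirectedOn (· ≤ ·) (Lset x) := by
  rintro u' ⟨u, hu, hu', hux⟩ v' ⟨v, hv, hv', hvx⟩
  obtain ⟨u₁, hu₁, hu₁u⟩ := hu'.exists_between
  obtain ⟨v₁, hv₁, hv₁v⟩ := hv'.exists_between
  obtain ⟨w, hw, hwx, huw, hvw⟩ :=
    hsep.exists_stronglySoft_ge hdiv hO5 hO6 hO7 hu hv hux.le hvx.le hu₁u hv₁v
  obtain ⟨m, hum, hvm, hmw⟩ := (hu₁.trans_le huw).exists_max (hv₁.trans_le hvw)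
  exact ⟨m, hw.mem_Lset hdiv hwx hmw, hum, hvm⟩

lemma zero_mem_Lset (x : S) : (0 : S) ∈ Lset x := by
  have hzero : ∀ y : S, (0 : S) ≪ y := fun y z _ _ _ _ => ⟨0, CuSemigroup.zero_le _⟩
  refine ⟨0, fun y hy => ⟨0, ?_, ?_⟩, hzero _, hzero _⟩
  · simpa using hy
  · exact hy.trans_le (CuSemigroup.zero_le _)

/-- In a countably based Cu-semigroup, an element way below the supremum of a directed `Lset`
is dominated by a member. -/
lemma CountablyBased.exists_mem_Lset (hcb : CountablyBased S) {x s s' : S}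
    (hdir : DirectedOn (· ≤ ·) (Lset x)) (hs : IsLUB (Lset x) s) (hs' : s' ≪ s) :
    ∃ q ∈ Lset x, s' ≤ q := by
  obtain ⟨D, hD, hbase⟩ := hcb
  have hcof : ∀ u ∈ Lset x, ∃ d ∈ D ∩ Lset x, u ≤ d := by
    rintro u' ⟨u, hu, hu', hux⟩
    obtain ⟨u₁, hu₁, hu₁u⟩ := hu'.exists_between
    obtain ⟨z, hz, hzD, hzu⟩ := hbase u₁
    obtain ⟨n, hn⟩ := hu₁ z hz u₁ hzu le_rfl
    exact ⟨z n, ⟨hzD n, u, hu, hu₁u.of_le (hzu.1 ⟨n, rfl⟩), hux⟩, hn⟩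
  obtain ⟨d₀, hd₀, -⟩ := hcof 0 (zero_mem_Lset x)
  obtain ⟨f, hf⟩ := (hD.mono inter_subset_left : (D ∩ Lset x).Countable).exists_eq_range ⟨d₀, hd₀⟩
  have hfL : ∀ n, f n ∈ Lset x := fun n => (hf ▸ mem_range_self n : f n ∈ D ∩ Lset x).2
  have hnext : ∀ (n : ℕ) (q : Lset x), ∃ r : Lset x, (q : S) ≤ r ∧ f n ≤ r := by
    rintro n ⟨q, hq⟩
    obtain ⟨r, hr, hqr, hfr⟩ := hdir q hq (f n) (hfL n)
    exact ⟨⟨r, hr⟩, hqr, hfr⟩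
  choose next hle hfle using hnext
  let q : ℕ → Lset x := fun n => Nat.rec ⟨0, zero_mem_Lset x⟩ next n
  have hq : Monotone fun n => (q n).1 := by
    refine monotone_nat_of_le_succ fun n => ?_
    exact hle n (q n)
  have hsq : IsLUB (range fun n => (q n).1) s := by
    refine ⟨?_, fun b hb => hs.2 fun u hu => ?_⟩
    · rintro _ ⟨n, rfl⟩
      exact hs.1 (q n).2
    · obtain ⟨d, hd, hud⟩ := hcof u hu
      obtain ⟨n, rfl⟩ := hf ▸ hd
      exact hud.trans ((hfle n (q n)).trans (hb ⟨n + 1, rfl⟩))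
  obtain ⟨n, hn⟩ := hs' _ hq s hsq le_rfl
  exact ⟨(q n).1, (q n).2, hn⟩

lemma TwoOmegaDivisible.add_le_two_nsmul_of_mem_Lset (hdiv : TwoOmegaDivisible S)
    (hO5 : SatisfiesO5 S) (hO6 : SatisfiesO6 S) {x x' s q : S} (hs : IsLUB (Lset x) s)
    (hx' : x' ≪ x) (hq : q ∈ Lset x) : x' + q ≤ 2 • s := by
  obtain ⟨u, hu, hqu, hux⟩ := hq
  obtain ⟨y, hxy, hyx⟩ := hx'.exists_between
  obtain ⟨q₁, hq₁, hq₁u⟩ := hqu.exists_between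
  obtain ⟨g, hg, hgx, hq₁g, hyg⟩ :=
    hu.exists_complement hdiv hO5 hux.le hq₁u (hyx.trans_le (le_infty x))
  have hgx' : q₁ + g ≤ x := by
    refine (add_le_add le_rfl ?_).trans hgx
    rw [two_nsmul]
    exact CuSemigroup.self_le_add _ _
  have hqy : q + y ≪ infty g :=
    ((hq₁.trans_le hq₁g).add hyg).trans_le (infty_add_infty_le g)
  obtain ⟨g', hg', hqyg'⟩ := hqy.exists_infty
  obtain ⟨k, hk, hgk, hkg⟩ := hg.exists_between hdiv hg'
  have hqyk : q + y ≤ infty k := hqyg'.le.trans (infty_mono hgk.le)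
  obtain ⟨w, hqw, hw⟩ := (hq₁.add hkg).exists_between
  obtain ⟨w₁, hw₁, hw₁g⟩ := hw.exists_between
  obtain ⟨c, -, hcx, hxc⟩ := hO5 w w₁ 0 0 x hw₁
    (fun z _ _ _ _ => ⟨0, CuSemigroup.zero_le _⟩)
    (by simpa using hw₁g.le.trans hgx')
  obtain ⟨f, d, -, hfw, hdy, hdc, hxfd⟩ := hO6 x' y w₁ c hxy (hyx.trans_le hxc)
  have hf : f ≤ s := (hfw.trans hw₁g.le).trans
    ((hg.add_of_le_infty hq₁g).le_of_isLUB_Lset hdiv hgx' hs)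
  have hsoft : StronglySoft (d + q + k) := by
    refine hk.add_of_le_infty (le_trans ?_ hqyk)
    rw [add_comm d q]
    exact add_le_add le_rfl hdy
  have hd : d + q + k ≤ s := by
    refine hsoft.le_of_isLUB_Lset hdiv ?_ hs
    rw [add_assoc, add_comm]
    exact (add_le_add hqw.le hdc).trans hcx
  calc x' + q ≤ f + d + q := add_le_add hxfd le_rfl
    _ = f + (d + q) := add_assoc _ _ _
    _ ≤ s + s := add_le_add hf ((CuSemigroup.self_le_add _ _).trans hd)
    _ = 2 • s := (two_nsmul s).symm

end WayBelowCalculus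

/-- In a countably based, left-soft separative, (2,ω)-divisible
Cu-semigroup satisfying (O5)-(O7), the supremum `σ(x)` of `L_x` satisfies
`2σ(x) = x + σ(x)`. -/
theorem two_sigma_eq {S : Type*} [CuSemigroup S]
    (hcb : CountablyBased S) (hsep : LeftSoftSeparative S)
    (hdiv : TwoOmegaDivisible S)
    (hO5 : SatisfiesO5 S) (hO6 : SatisfiesO6 S) (hO7 : SatisfiesO7 S)
    (x s : S) (hs : IsLUB (Lset x) s) :
    2 • s = x + s := by
  have hdir := hsep.directedOn_Lset hdiv hO5 hO6 hO7 x
  refine le_antisymm ?_ (add_le_of_forall_wayBelow fun x' s' hx' hs' => ?_)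
  · rw [two_nsmul]
    refine add_le_add (hs.2 ?_) le_rfl
    rintro u' ⟨u, -, hu', hux⟩
    exact hu'.le.trans hux.le
  · obtain ⟨q, hq, hsq⟩ := hcb.exists_mem_Lset hdir hs hs'
    exact (add_le_add le_rfl hsq).trans
      (hdiv.add_le_two_nsmul_of_mem_Lset hO5 hO6 hs hx' hq)
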